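/- Let L be a factorial extensible visibly pushdown language over a pushdown alphabet A. Then B⁻¹(L), the set of bi-infinite sequences over A all of whose finite factors belong to L, is a sofic-Dyck shift over A. -/

import Mathlib

namespace SD

/-- The three kinds of letters of a pushdown alphabet. -/
inductive LetterKind : Type
  | call
  | ret
  | intern
  deriving DecidableEq

/-- A pushdown alphabet structure on `A`: a partition of the letters into
call letters, return letters and internal letters. -/
structure PushdownAlphabet (A : Type*) where
  kind : A → LetterKind

/-- Number of call letters of a word. -/
def callCount {A : Type*} (P : PushdownAlphabet A) (u : List A) : ℕ :=
  u.countP (fun a => decide (P.kind a = LetterKind.call))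

/-- Number of return letters of a word. -/
def retCount {A : Type*} (P : PushdownAlphabet A) (u : List A) : ℕ :=
  u.countP (fun a => decide (P.kind a = LetterKind.ret))

/-- A word is matched-return if every prefix has at least as many call letters
as return letters. -/
def MatchedReturn {A : Type*} (P : PushdownAlphabet A) (u : List A) : Prop :=
  ∀ v w : List A, u = v ++ w → retCount P v ≤ callCount P v

/-- A word is matched-call if every suffix has at least as many return letters
as call letters. -/
def MatchedCall {A : Type*} (P : PushdownAlphabet A) (u : List A) : Prop :=
  ∀ v w : List A, u = v ++ w → callCount P w ≤ retCount P w

/-- A Dyck word is a word which is both matched-return and matched-call. -/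
def IsDyck {A : Type*} (P : PushdownAlphabet A) (u : List A) : Prop :=
  MatchedReturn P u ∧ MatchedCall P u

/-- The factor of length `n` of a bi-infinite sequence starting at position `i`. -/
def factorAt {A : Type*} (x : ℤ → A) (i : ℤ) (n : ℕ) : List A :=
  (List.range n).map (fun k => x (i + (k : ℤ)))

/-- `w` is a (finite) factor of the bi-infinite sequence `x`. -/
def IsFactorOf {A : Type*} (w : List A) (x : ℤ → A) : Prop :=
  ∃ i : ℤ, w = factorAt x i w.length

/-- A Dyck automaton over alphabet `A` with states `Q`: a labeled graph together
with a set of matched pairs of edges. -/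
structure DyckAutomaton (A : Type*) (Q : Type*) where
  edges : Set (Q × A × Q)
  matched : Set ((Q × A × Q) × (Q × A × Q))

/-- Well-formedness of a Dyck automaton: matched pairs consist of edges of the
automaton, a call edge followed by a return edge. -/
def DyckAutomaton.WellFormed {A Q : Type*} (P : PushdownAlphabet A)
    (𝒜 : DyckAutomaton A Q) : Prop :=
  ∀ e f : Q × A × Q, (e, f) ∈ 𝒜.matched →
    e ∈ 𝒜.edges ∧ f ∈ 𝒜.edges ∧
    P.kind e.2.1 = LetterKind.call ∧ P.kind f.2.1 = LetterKind.ret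

/-- The label of a finite path. -/
def pathLabel {A Q : Type*} (π : List (Q × A × Q)) : List A :=
  π.map (fun e => e.2.1)

/-- A finite path of the underlying graph: a sequence of consecutive edges. -/
def IsPath {A Q : Type*} (𝒜 : DyckAutomaton A Q) (π : List (Q × A × Q)) : Prop :=
  (∀ e ∈ π, e ∈ 𝒜.edges) ∧ π.Chain' (fun e f => e.2.2 = f.1)

/-- A finite path is admissible if for any factor `e · π₁ · f` of it with `e` a call
edge, `f` a return edge and the label of `π₁` a Dyck word, `(e,f)` is a matched pair. -/
def IsAdmissible {A Q : Type*} (P : PushdownAlphabet A) (𝒜 : DyckAutomaton A Q)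
    (π : List (Q × A × Q)) : Prop :=
  IsPath 𝒜 π ∧
  ∀ (π₀ : List (Q × A × Q)) (e : Q × A × Q) (π₁ : List (Q × A × Q)) (f : Q × A × Q)
    (π₂ : List (Q × A × Q)), π = π₀ ++ e :: π₁ ++ f :: π₂ →
    P.kind e.2.1 = LetterKind.call → P.kind f.2.1 = LetterKind.ret →
    IsDyck P (pathLabel π₁) → (e, f) ∈ 𝒜.matched

/-- The finite factor of a bi-infinite path starting at index `i`, of length `n`. -/
def pathSeg {A Q : Type*} (π : ℤ → Q × A × Q) (i : ℤ) (n : ℕ) : List (Q × A × Q) :=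
  (List.range n).map (fun k => π (i + (k : ℤ)))

/-- A bi-infinite path is admissible if it is a bi-infinite path of the graph all of
whose finite factors are admissible. -/
def BiAdmissible {A Q : Type*} (P : PushdownAlphabet A) (𝒜 : DyckAutomaton A Q)
    (π : ℤ → Q × A × Q) : Prop :=
  (∀ i : ℤ, π i ∈ 𝒜.edges) ∧ (∀ i : ℤ, (π i).2.2 = (π (i + 1)).1) ∧
  ∀ (i : ℤ) (n : ℕ), IsAdmissible P 𝒜 (pathSeg π i n)

/-- The sofic-Dyck shift presented by a Dyck automaton: the set of labels of
bi-infinite admissible paths. -/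
def presents {A Q : Type*} (P : PushdownAlphabet A) (𝒜 : DyckAutomaton A Q) :
    Set (ℤ → A) :=
  { x | ∃ π : ℤ → Q × A × Q, BiAdmissible P 𝒜 π ∧ ∀ i : ℤ, (π i).2.1 = x i }

/-- A sofic-Dyck shift over `A`: a set presented by some (finite, well-formed)
Dyck automaton. -/
def IsSoficDyck {A : Type*} (P : PushdownAlphabet A) (X : Set (ℤ → A)) : Prop :=
  ∃ (N : ℕ) (𝒜 : DyckAutomaton A (Fin N)), 𝒜.WellFormed P ∧ X = presents P 𝒜

/-- A finite path goes from `p` to `q` (an empty path goes from `p` to `p`). -/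
def GoesFromTo {A Q : Type*} (π : List (Q × A × Q)) (p q : Q) : Prop :=
  (∀ e ∈ π.head?, e.1 = p) ∧ (∀ e ∈ π.getLast?, e.2.2 = q) ∧ (π = [] → p = q)

/-- A finite path starts at state `p`. -/
def StartsAt {A Q : Type*} (π : List (Q × A × Q)) (p : Q) : Prop :=
  ∀ e ∈ π.head?, e.1 = p

/-- A visibly pushdown automaton over `A` with states `Q` and stack alphabet `Γ`
(with a distinguished bottom-of-stack symbol `bot`). -/
structure VPA (A : Type*) (Q : Type*) (Γ : Type*) where
  init : Set Q
  bot : Γ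
  push : Set (Q × A × Q × Γ)
  pop : Set (Q × A × Γ × Q)
  internal : Set (Q × A × Q)
  final : Set Q

/-- `VPA.Steps P V c w c'` : there is a run of the visibly pushdown automaton `V`
labeled by `w` from configuration `c` to configuration `c'`.  A configuration is a
pair of a state and a stack; stacks are represented by the list of their symbols
above the bottom symbol, with the top of the stack at the end of the list. -/
inductive VPA.Steps {A Q Γ : Type*} (P : PushdownAlphabet A) (V : VPA A Q Γ) :
    Q × List Γ → List A → Q × List Γ → Prop
  | refl (c : Q × List Γ) : VPA.Steps P V c [] c
  | call {p : Q} {σ : List Γ} {a : A} {q : Q} {γ : Γ} {w : List A} {c : Q × List Γ} :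
      P.kind a = LetterKind.call → (p, a, q, γ) ∈ V.push → γ ≠ V.bot →
      VPA.Steps P V (q, σ ++ [γ]) w c → VPA.Steps P V (p, σ) (a :: w) c
  | pop {p : Q} {σ : List Γ} {a : A} {γ : Γ} {q : Q} {w : List A} {c : Q × List Γ} :
      P.kind a = LetterKind.ret → (p, a, γ, q) ∈ V.pop → γ ≠ V.bot →
      VPA.Steps P V (q, σ) w c → VPA.Steps P V (p, σ ++ [γ]) (a :: w) c
  | popBot {p : Q} {a : A} {q : Q} {w : List A} {c : Q × List Γ} :
      P.kind a = LetterKind.ret → (p, a, V.bot, q) ∈ V.pop →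
      VPA.Steps P V (q, []) w c → VPA.Steps P V (p, []) (a :: w) c
  | internal {p : Q} {σ : List Γ} {a : A} {q : Q} {w : List A} {c : Q × List Γ} :
      P.kind a = LetterKind.intern → (p, a, q) ∈ V.internal →
      VPA.Steps P V (q, σ) w c → VPA.Steps P V (p, σ) (a :: w) c

/-- A word is accepted by a visibly pushdown automaton if it labels a run from an
initial state with empty stack to a final state. -/
def VPA.Accepts {A Q Γ : Type*} (P : PushdownAlphabet A) (V : VPA A Q Γ)
    (w : List A) : Prop :=
  ∃ (p q : Q) (σ : List Γ), p ∈ V.init ∧ q ∈ V.final ∧ VPA.Steps P V (p, []) w (q, σ)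

/-- A visibly pushdown language over `A`: the set of words accepted by some (finite)
visibly pushdown automaton over `A`. -/
def IsVPL {A : Type*} (P : PushdownAlphabet A) (L : Set (List A)) : Prop :=
  ∃ (nQ nΓ : ℕ) (V : VPA A (Fin nQ) (Fin (nΓ + 1))),
    L = { w | VPA.Accepts P V w }

/-- A language is factorial if it contains every factor of each of its words. -/
def FactorialLang {A : Type*} (L : Set (List A)) : Prop :=
  ∀ u v w : List A, u ++ v ++ w ∈ L → v ∈ L

/-- A language is extensible if every word of it extends on both sides by nonempty
words to a word of the language. -/
def ExtensibleLang {A : Type*} (L : Set (List A)) : Prop :=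
  ∀ u ∈ L, ∃ w z : List A, w ≠ [] ∧ z ≠ [] ∧ w ++ u ++ z ∈ L

/-- The bi-extensible subset of `L`: words of `L` extensible on both sides by
arbitrarily long words within `L`. -/
def BiExt {A : Type*} (L : Set (List A)) : Set (List A) :=
  { w | w ∈ L ∧ ∀ n : ℕ, ∃ u v : List A, n ≤ u.length ∧ n ≤ v.length ∧ u ++ w ++ v ∈ L }

/-- The set of blocks (finite factors) of a set of bi-infinite sequences. -/
def blocksOf {A : Type*} (X : Set (ℤ → A)) : Set (List A) :=
  { w | ∃ x ∈ X, IsFactorOf w x }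

end SD

open SD

namespace SD

section Counting

variable {A : Type*} {P : PushdownAlphabet A}

@[simp] theorem callCount_append (u v : List A) :
    callCount P (u ++ v) = callCount P u + callCount P v := by
  simp [callCount]

@[simp] theorem retCount_append (u v : List A) :
    retCount P (u ++ v) = retCount P u + retCount P v := by
  simp [retCount]

@[simp] theorem callCount_nil : callCount P [] = 0 := rfl

@[simp] theorem retCount_nil : retCount P [] = 0 := rfl

theorem callCount_cons (a : A) (u : List A) :
    callCount P (a :: u) = callCount P u + if P.kind a = .call then 1 else 0 := by
  simp [callCount, List.countP_cons]

theorem retCount_cons (a : A) (u : List A) :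
    retCount P (a :: u) = retCount P u + if P.kind a = .ret then 1 else 0 := by
  simp [retCount, List.countP_cons]

theorem MatchedReturn.retCount_le {u : List A} (h : MatchedReturn P u) :
    retCount P u ≤ callCount P u := h u [] (by simp)

theorem MatchedCall.callCount_le {u : List A} (h : MatchedCall P u) :
    callCount P u ≤ retCount P u := h [] u (by simp)

theorem MatchedReturn.append {u v : List A} (hu : MatchedReturn P u)
    (hv : MatchedReturn P v) : MatchedReturn P (u ++ v) := by
  intro x y h
  rcases List.append_eq_append_iff.1 h with ⟨z, rfl, rfl⟩ | ⟨z, rfl, rfl⟩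
  · have h₁ := hu.retCount_le
    have h₂ := hv z y rfl
    simp only [callCount_append, retCount_append]
    omega
  · exact hu x z rfl

theorem MatchedCall.append {u v : List A} (hu : MatchedCall P u)
    (hv : MatchedCall P v) : MatchedCall P (u ++ v) := by
  intro x y h
  rcases List.append_eq_append_iff.1 h with ⟨z, rfl, rfl⟩ | ⟨z, rfl, rfl⟩
  · exact hv z y rfl
  · have h₁ := hv.callCount_le
    have h₂ := hu x z rfl
    simp only [callCount_append, retCount_append]
    omega

theorem MatchedReturn.cons_call {a : A} {u : List A} (ha : P.kind a = .call)
    (hu : MatchedReturn P u) : MatchedReturn P (a :: u) := by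
  intro x y h
  rcases List.cons_eq_append_iff.1 h with ⟨rfl, -⟩ | ⟨z, rfl, rfl⟩
  · simp
  · have := hu z y rfl
    simp only [callCount_cons, retCount_cons, ha]
    simp
    omega

theorem isDyck_nil : IsDyck P [] := by
  constructor <;> intro x y h <;> obtain ⟨rfl, rfl⟩ := List.nil_eq_append_iff.1 h <;> simp

theorem IsDyck.append {u v : List A} (hu : IsDyck P u) (hv : IsDyck P v) :
    IsDyck P (u ++ v) :=
  ⟨hu.1.append hv.1, hu.2.append hv.2⟩

theorem isDyck_intern {a : A} (ha : P.kind a = .intern) : IsDyck P [a] := by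
  constructor <;> intro x y h <;>
    rcases List.cons_eq_append_iff.1 h with ⟨rfl, rfl⟩ | ⟨z, rfl, h'⟩
  · simp
  · obtain ⟨rfl, rfl⟩ := List.nil_eq_append_iff.1 h'
    simp [callCount_cons, retCount_cons, ha]
  · simp [callCount_cons, retCount_cons, ha]
  · obtain ⟨rfl, rfl⟩ := List.nil_eq_append_iff.1 h'
    simp

theorem IsDyck.nest {a b : A} {u : List A} (ha : P.kind a = .call) (hb : P.kind b = .ret)
    (hu : IsDyck P u) : IsDyck P (a :: (u ++ [b])) := by
  have h₁ := hu.1.retCount_le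
  have h₂ := hu.2.callCount_le
  constructor <;> intro x y h <;>
    rcases List.cons_eq_append_iff.1 h with ⟨rfl, rfl⟩ | ⟨z, rfl, h'⟩
  · simp
  · rcases List.append_eq_append_iff.1 h' with ⟨t, rfl, h''⟩ | ⟨t, rfl, h''⟩
    · rcases List.cons_eq_append_iff.1 h'' with ⟨rfl, rfl⟩ | ⟨t, rfl, h₃⟩
      · simp [callCount_cons, retCount_cons, ha]; omega
      · obtain ⟨rfl, rfl⟩ := List.nil_eq_append_iff.1 h₃
        simp [callCount_cons, retCount_cons, ha, hb]; omega
    · have := hu.1 z t rfl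
      simp [callCount_cons, retCount_cons, ha]; omega
  · simp [callCount_cons, retCount_cons, ha, hb]; omega
  · rcases List.append_eq_append_iff.1 h' with ⟨t, rfl, h''⟩ | ⟨t, rfl, rfl⟩
    · rcases List.cons_eq_append_iff.1 h'' with ⟨rfl, rfl⟩ | ⟨t, rfl, h₃⟩
      · simp [callCount_cons, retCount_cons, hb]
      · obtain ⟨rfl, rfl⟩ := List.nil_eq_append_iff.1 h₃
        simp
    · have := hu.2 z t rfl
      simp [callCount_cons, retCount_cons, hb]; omega

/-- A return letter following a Dyck word is never matched inside that word. -/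
theorem IsDyck.not_matchedReturn {b : A} {u v : List A} (hb : P.kind b = .ret)
    (hu : IsDyck P u) : ¬ MatchedReturn P (u ++ b :: v) := by
  intro h
  have h₁ := h (u ++ [b]) v (by simp)
  have h₂ := hu.2.callCount_le
  simp [callCount_cons, retCount_cons, hb] at h₁
  omega

end Counting

section Runs

variable {A Q Γ : Type*}

/-- A frame of a run: the state reached by the pending call opening it (`none` at the bottom
of the stack) and the state from which the matching return leaves it (`none` if it is never
closed). -/
abbrev Frame (Q : Type*) := Option Q × Option Q

/-- Edges of the Dyck automaton whose states are states of a visibly pushdown automaton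
annotated with their frame. -/
abbrev FrameEdge (A Q : Type*) := (Frame Q × Q) × A × (Frame Q × Q)

variable (P : PushdownAlphabet A) (V : VPA A Q Γ)

namespace VPA

/-- A one-letter move inside the frame `f`. -/
def LevelStep (f : Frame Q) (p : Q) (a : A) (q : Q) : Prop :=
  (P.kind a = .intern ∧ (p, a, q) ∈ V.internal) ∨
    (f.1 = none ∧ P.kind a = .ret ∧ (p, a, V.bot, q) ∈ V.pop)

/-- The call transition `p → s` labeled `a` pushes some symbol popped by the return
transition `t → q` labeled `b`. -/
def MatchStep (p : Q) (a : A) (s t : Q) (b : A) (q : Q) : Prop :=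
  P.kind a = .call ∧ P.kind b = .ret ∧
    ∃ γ, γ ≠ V.bot ∧ (p, a, s, γ) ∈ V.push ∧ (t, b, γ, q) ∈ V.pop

/-- The call transition `p → s` labeled `a` is possible. -/
def PushStep (p : Q) (a : A) (s : Q) : Prop :=
  P.kind a = .call ∧ ∃ γ, γ ≠ V.bot ∧ (p, a, s, γ) ∈ V.push

/-- `Mid P V f p π q`: the annotated path `π` leads from `p` to `q`, both in the frame `f`,
opening and closing further frames in between. -/
inductive Mid : Frame Q → Q → List (FrameEdge A Q) → Q → Prop
  | nil (f : Frame Q) (p : Q) : Mid f p [] p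
  | step {f : Frame Q} {p : Q} {a : A} {q : Q} {π : List (FrameEdge A Q)} {r : Q} :
      LevelStep P V f p a q → Mid f q π r → Mid f p (((f, p), a, (f, q)) :: π) r
  | nest {f : Frame Q} {p : Q} {a : A} {s t : Q} {b : A} {q : Q}
      {π ρ : List (FrameEdge A Q)} {r : Q} :
      MatchStep P V p a s t b q → Mid (some s, some t) s π t → Mid f q ρ r →
      Mid f p (((f, p), a, ((some s, some t), s)) ::
        (π ++ (((some s, some t), t), b, (f, q)) :: ρ)) r

/-- The state `q` is where a run inside the frame `f` starts. -/
def IsEntry (f : Frame Q) (q : Q) : Prop := f.1 = some q ∨ (f.1 = none ∧ q ∈ V.init)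

/-- The state `q` is where a run inside the frame `f` stops. -/
def IsExit (f : Frame Q) (q : Q) : Prop := f.2 = some q ∨ (f.2 = none ∧ q ∈ V.final)

/-- `Comp P V f p π`: the annotated path `π` completes the frame `f` from the state `p`. -/
inductive Comp : Frame Q → Q → List (FrameEdge A Q) → Prop
  | exit {f : Frame Q} {p : Q} {π : List (FrameEdge A Q)} {q : Q} :
      Mid P V f p π q → IsExit V f q → Comp f p π
  | pending {f : Frame Q} {p : Q} {π : List (FrameEdge A Q)} {q : Q} {a : A} {s : Q}
      {ρ : List (FrameEdge A Q)} :
      Mid P V f p π q → f.2 = none → PushStep P V q a s → Comp (some s, none) s ρ →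
      Comp f p (π ++ ((f, q), a, ((some s, none), s)) :: ρ)

/-- The annotated paths following accepting runs of the automaton. -/
def Full (π : List (FrameEdge A Q)) : Prop :=
  ∃ q ∈ V.init, Comp P V (none, none) q π

/-- `Ctx P V f α δ`: an accepting run may read `α`, then a complete run of the
frame `f`, and then `δ`. -/
inductive Ctx : Frame Q → List (FrameEdge A Q) → List (FrameEdge A Q) → Prop
  | base : Ctx (none, none) [] []
  | nest {f : Frame Q} {α δ β β' : List (FrameEdge A Q)} {p₀ p : Q} {a : A} {s t : Q} {b : A}
      {q : Q} :
      Ctx f α δ → IsEntry V f p₀ → Mid P V f p₀ β p → MatchStep P V p a s t b q →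
      Comp P V f q β' →
      Ctx (some s, some t) (α ++ β ++ [((f, p), a, ((some s, some t), s))])
        ((((some s, some t), t), b, (f, q)) :: (β' ++ δ))
  | pending {f : Frame Q} {α δ β : List (FrameEdge A Q)} {p₀ p : Q} {a : A} {s : Q} :
      Ctx f α δ → f.2 = none → IsEntry V f p₀ → Mid P V f p₀ β p → PushStep P V p a s →
      Ctx (some s, none) (α ++ β ++ [((f, p), a, ((some s, none), s))]) δ

/-- `Zip P V x X Y`: some accepting run follows `X` to the annotated state `x` and then
continues along `Y`. -/
def Zip (x : Frame Q × Q) (X Y : List (FrameEdge A Q)) : Prop :=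
  ∃ α β β' δ p₀, Ctx P V x.1 α δ ∧ IsEntry V x.1 p₀ ∧ Mid P V x.1 p₀ β x.2 ∧
    Comp P V x.1 x.2 β' ∧ X = α ++ β ∧ Y = β' ++ δ

variable {P V}

theorem Mid.append {f : Frame Q} {p q r : Q} {π ρ : List (FrameEdge A Q)}
    (h : Mid P V f p π q) (h' : Mid P V f q ρ r) : Mid P V f p (π ++ ρ) r := by
  induction h with
  | nil => exact h'
  | step hs _ ih => exact .step hs (ih h')
  | nest hm h₁ _ _ ih => simpa using Mid.nest hm h₁ (ih h')

theorem Mid.append_comp {f : Frame Q} {p q : Q} {π ρ : List (FrameEdge A Q)}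
    (h : Mid P V f p π q) (h' : Comp P V f q ρ) : Comp P V f p (π ++ ρ) := by
  cases h' with
  | exit h₁ h₂ => exact .exit (h.append h₁) h₂
  | pending h₁ h₂ h₃ h₄ => simpa using Comp.pending (h.append h₁) h₂ h₃ h₄

theorem Comp.nest {f : Frame Q} {p : Q} {a : A} {s t : Q} {b : A} {q : Q}
    {π ρ : List (FrameEdge A Q)} (hm : MatchStep P V p a s t b q)
    (h : Mid P V (some s, some t) s π t) (h' : Comp P V f q ρ) :
    Comp P V f p (((f, p), a, ((some s, some t), s)) ::
      (π ++ (((some s, some t), t), b, (f, q)) :: ρ)) := by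
  simpa using (Mid.nest hm h (.nil f q)).append_comp h'

theorem Comp.mid {f : Frame Q} {p t : Q} {π : List (FrameEdge A Q)} (hf : f.2 = some t)
    (h : Comp P V f p π) : Mid P V f p π t := by
  cases h with
  | exit h₁ h₂ =>
    rcases h₂ with h₂ | ⟨h₂, -⟩
    · obtain rfl : t = _ := Option.some_injective _ (hf.symm.trans h₂)
      exact h₁
    · simp [hf] at h₂
  | pending _ h₂ => simp [hf] at h₂

theorem Ctx.fill {f : Frame Q} {α δ : List (FrameEdge A Q)} (hC : Ctx P V f α δ) :
    ∀ {p₀ q : Q} {β β' : List (FrameEdge A Q)}, IsEntry V f p₀ → Mid P V f p₀ β q →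
      Comp P V f q β' → Full P V (α ++ β ++ β' ++ δ) := by
  induction hC with
  | base =>
    intro p₀ q β β' h₀ h₁ h₂
    rcases h₀ with h₀ | ⟨-, h₀⟩
    · simp at h₀
    · exact ⟨p₀, h₀, by simpa using h₁.append_comp h₂⟩
  | nest _ hE hM hS hR ih =>
    intro p₀ q β β' h₀ h₁ h₂
    obtain rfl : _ = p₀ := by simpa [IsEntry] using h₀
    have := ih hE hM (Comp.nest hS (h₁.append (h₂.mid rfl)) hR)
    simpa using this
  | pending _ hf hE hM hS ih =>
    intro p₀ q β β' h₀ h₁ h₂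
    obtain rfl : _ = p₀ := by simpa [IsEntry] using h₀
    have := ih hE hM (Comp.pending (.nil _ _) hf hS (h₁.append_comp h₂))
    simpa using this

theorem Zip.full {x : Frame Q × Q} {X Y : List (FrameEdge A Q)} (h : Zip P V x X Y) :
    Full P V (X ++ Y) := by
  obtain ⟨α, β, β', δ, p₀, hC, hE, hM, hR, rfl, rfl⟩ := h
  simpa using hC.fill hE hM hR

theorem Full.zip {π : List (FrameEdge A Q)} (h : Full P V π) :
    ∃ x, Zip P V x [] π := by
  obtain ⟨q, hq, h⟩ := h
  exact ⟨((none, none), q), [], [], π, [], q, .base, .inr ⟨rfl, hq⟩, .nil _ _, h, by simp,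
    by simp⟩

/-- The possible shapes of a completion of a frame, according to its first edge. -/
theorem Comp.casesHead {f : Frame Q} {p : Q} {π : List (FrameEdge A Q)}
    (h : Comp P V f p π) :
    (π = [] ∧ IsExit V f p) ∨
    (∃ a q ρ, LevelStep P V f p a q ∧ Comp P V f q ρ ∧ π = ((f, p), a, (f, q)) :: ρ) ∨
    (∃ a s t b q ρ σ, MatchStep P V p a s t b q ∧ Mid P V (some s, some t) s ρ t ∧
      Comp P V f q σ ∧ π = ((f, p), a, ((some s, some t), s)) ::
        (ρ ++ (((some s, some t), t), b, (f, q)) :: σ)) ∨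
    (∃ a s ρ, f.2 = none ∧ PushStep P V p a s ∧ Comp P V (some s, none) s ρ ∧
      π = ((f, p), a, ((some s, none), s)) :: ρ) := by
  cases h with
  | exit h₁ h₂ =>
    cases h₁ with
    | nil => exact .inl ⟨rfl, h₂⟩
    | step hs h => exact .inr (.inl ⟨_, _, _, hs, .exit h h₂, rfl⟩)
    | nest hm h h' => exact .inr (.inr (.inl ⟨_, _, _, _, _, _, _, hm, h, .exit h' h₂, rfl⟩))
  | pending h₁ h₂ h₃ h₄ =>
    cases h₁ with
    | nil => exact .inr (.inr (.inr ⟨_, _, _, h₂, h₃, h₄, rfl⟩))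
    | step hs h => exact .inr (.inl ⟨_, _, _, hs, .pending h h₂ h₃ h₄, rfl⟩)
    | nest hm h h' =>
      exact .inr (.inr (.inl ⟨_, _, _, _, _, _, _, hm, h, .pending h' h₂ h₃ h₄, by simp⟩))

theorem Ctx.right_eq_nil {f : Frame Q} {α δ : List (FrameEdge A Q)} (hC : Ctx P V f α δ)
    (hf : f.2 = none) : δ = [] := by
  induction hC with
  | base => rfl
  | nest => simp at hf
  | pending _ h _ _ _ ih => exact ih h

theorem Ctx.closed_cases {f : Frame Q} {α δ : List (FrameEdge A Q)} {t : Q}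
    (hC : Ctx P V f α δ) (hf : f.2 = some t) :
    ∃ g α' δ' β β' p₀ p a s b q, f = (some s, some t) ∧ Ctx P V g α' δ' ∧ IsEntry V g p₀ ∧
      Mid P V g p₀ β p ∧ MatchStep P V p a s t b q ∧ Comp P V g q β' ∧
      α = α' ++ β ++ [((g, p), a, ((some s, some t), s))] ∧
      δ = (((some s, some t), t), b, (g, q)) :: (β' ++ δ') := by
  cases hC with
  | base => simp at hf
  | nest h₁ h₂ h₃ h₄ h₅ =>
    obtain rfl : _ = t := by simpa using hf
    exact ⟨_, _, _, _, _, _, _, _, _, _, _, rfl, h₁, h₂, h₃, h₄, h₅, rfl, rfl⟩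
  | pending => simp at hf

theorem Zip.cons {x : Frame Q × Q} {X Y : List (FrameEdge A Q)} {e : FrameEdge A Q}
    (h : Zip P V x X (e :: Y)) : e.1 = x ∧ Zip P V e.2.2 (X ++ [e]) Y := by
  obtain ⟨f, p⟩ := x
  obtain ⟨α, β, β', δ, p₀, hC, hE, hM, hR, rfl, hY⟩ := h
  dsimp only at hC hE hM hR
  rcases hR.casesHead with ⟨rfl, hx⟩ | ⟨a, q, ρ, hs, hq, rfl⟩ |
    ⟨a, s, t, b, q, ρ, σ, hs, hr, hq, rfl⟩ | ⟨a, s, ρ, hf, hs, hq, rfl⟩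
  · rcases hx with hx | ⟨hx, -⟩
    · obtain ⟨g, α', δ', γ, γ', r₀, r, a, s, b, q, rfl, hC', hE', hM', hS, hR', rfl, rfl⟩ :=
        hC.closed_cases hx
      obtain rfl : _ = p₀ := by simpa [IsEntry] using hE
      obtain ⟨rfl, rfl⟩ : e = _ ∧ Y = _ := by simpa using hY
      exact ⟨rfl, α', _, γ', δ', r₀, hC', hE',
        hM'.append (.nest hS hM (.nil _ _)), hR', by simp, by simp⟩
    · simp [hC.right_eq_nil hx] at hY
  · obtain ⟨rfl, rfl⟩ : e = _ ∧ Y = _ := by simpa using hY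
    exact ⟨rfl, α, _, ρ, δ, p₀, hC, hE, hM.append (.step hs (.nil _ _)), hq, by simp, rfl⟩
  · obtain ⟨rfl, rfl⟩ : e = _ ∧ Y = _ := by simpa using hY
    exact ⟨rfl, _, [], ρ, _, s, .nest hC hE hM hs hq, .inl rfl, .nil _ _, .exit hr (.inl rfl),
      by simp, by simp⟩
  · obtain ⟨rfl, rfl⟩ : e = _ ∧ Y = _ := by simpa using hY
    exact ⟨rfl, _, [], ρ, _, s, .pending hC hf hE hM hs, .inl rfl, .nil _ _, hq, by simp, rfl⟩

theorem Zip.append {X Y : List (FrameEdge A Q)} :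
    ∀ {Z : List (FrameEdge A Q)} {x : Frame Q × Q}, Zip P V x X (Y ++ Z) →
      ∃ y, Zip P V y (X ++ Y) Z := by
  induction Y generalizing X with
  | nil => exact fun {Z x} h => ⟨x, by simpa using h⟩
  | cons e Y ih =>
    intro Z x h
    simpa using ih h.cons.2

theorem Full.exists_zip {X Y : List (FrameEdge A Q)} (h : Full P V (X ++ Y)) :
    ∃ x, Zip P V x X Y := by
  obtain ⟨x, hx⟩ := h.zip
  simpa using hx.append

theorem Zip.isChain {Y : List (FrameEdge A Q)} :
    ∀ {X : List (FrameEdge A Q)} {x : Frame Q × Q}, Zip P V x X Y →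
      Y.IsChain (fun e f => e.2.2 = f.1) ∧ ∀ e ∈ Y.head?, x = e.1 := by
  induction Y with
  | nil => simp
  | cons e Y ih =>
    intro X x h
    obtain ⟨h₁, h₂⟩ := h.cons
    obtain ⟨h₃, h₄⟩ := ih h₂
    exact ⟨List.isChain_cons.2 ⟨h₄, h₃⟩, by simp [h₁]⟩

theorem Mid.isDyck {f : Frame Q} {p q : Q} {π : List (FrameEdge A Q)}
    (h : Mid P V f p π q) (hf : f.1 ≠ none) : IsDyck P (pathLabel π) := by
  induction h with
  | nil => exact isDyck_nil
  | step hs _ ih =>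
    rcases hs with ⟨hs, -⟩ | ⟨hs, -⟩
    · exact (isDyck_intern hs).append (ih hf)
    · exact absurd hs hf
  | nest hm _ _ ih₁ ih₂ =>
    simpa [pathLabel] using (IsDyck.nest hm.1 hm.2.1 (ih₁ (by simp))).append (ih₂ hf)

theorem Comp.matchedReturn {f : Frame Q} {p : Q} {π : List (FrameEdge A Q)}
    (h : Comp P V f p π) (hf : f.1 ≠ none) : MatchedReturn P (pathLabel π) := by
  induction h with
  | exit h => exact (h.isDyck hf).1
  | pending h _ hs _ ih =>
    simpa [pathLabel] using (h.isDyck hf).1.append ((ih (by simp)).cons_call hs.1)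

variable (P V) in
/-- The Dyck automaton whose edges are those of the annotated paths of accepting runs. -/
def frameAutomaton : DyckAutomaton A (Frame Q × Q) where
  edges := {e | ∃ X Y, Full P V (X ++ e :: Y)}
  matched := {m | (∃ X Y, Full P V (X ++ m.1 :: Y)) ∧ (∃ X Y, Full P V (X ++ m.2 :: Y)) ∧
    ∃ f p a s t b q, MatchStep P V p a s t b q ∧
      m.1 = ((f, p), a, ((some s, some t), s)) ∧ m.2 = (((some s, some t), t), b, (f, q))}

theorem frameAutomaton_wellFormed : (frameAutomaton P V).WellFormed P := by
  rintro e e' ⟨he, he', f, p, a, s, t, b, q, hm, h₁, h₂⟩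
  dsimp only at h₁ h₂
  subst h₁ h₂
  exact ⟨he, he', hm.1, hm.2.1⟩

/-- Following a call edge, a Dyck word and a return edge, an accepting run uses a matched
pair of edges. -/
theorem Full.matched {π₀ π₁ π₂ : List (FrameEdge A Q)} {e e' : FrameEdge A Q}
    (h : Full P V (π₀ ++ e :: (π₁ ++ e' :: π₂))) (he : P.kind e.2.1 = .call)
    (he' : P.kind e'.2.1 = .ret) (h₁ : IsDyck P (pathLabel π₁)) :
    (e, e') ∈ (frameAutomaton P V).matched := by
  refine ⟨⟨_, _, h⟩, ⟨π₀ ++ e :: π₁, π₂, by simpa using h⟩, ?_⟩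
  obtain ⟨⟨f, p⟩, α, β, β', δ, p₀, hC, hE, hM, hR, rfl, hY⟩ := h.exists_zip
  dsimp only at hC hE hM hR
  rcases hR.casesHead with ⟨rfl, hx⟩ | ⟨a, q, ρ, hs, hq, rfl⟩ |
    ⟨a, s, t, b, q, ρ, σ, hs, hr, hq, rfl⟩ | ⟨a, s, ρ, hf, hs, hq, rfl⟩
  · rcases hx with hx | ⟨hx, -⟩
    · obtain ⟨g, α', δ', γ, γ', r₀, r, a, s, b, q, rfl, hC', hE', hM', hS, hR', rfl, rfl⟩ :=
        hC.closed_cases hx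
      obtain ⟨rfl, -⟩ : e = _ ∧ _ := by simpa using hY
      simp [hS.2.1] at he
    · simp [hC.right_eq_nil hx] at hY
  · obtain ⟨rfl, -⟩ : e = _ ∧ _ := by simpa using hY
    rcases hs with ⟨hs, -⟩ | ⟨-, hs, -⟩ <;> simp [hs] at he
  · obtain ⟨rfl, h₂⟩ : e = _ ∧ π₁ ++ e' :: π₂ = ρ ++ _ :: (σ ++ δ) := by simpa using hY
    have hρ := hr.isDyck (by simp)
    rcases List.append_eq_append_iff.1 h₂ with ⟨z, rfl, h₃⟩ | ⟨z, rfl, h₃⟩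
    · rcases List.cons_eq_append_iff.1 h₃ with ⟨rfl, h₄⟩ | ⟨z, rfl, -⟩
      · obtain ⟨rfl, -⟩ : _ = e' ∧ _ := by simpa using h₄
        exact ⟨f, p, a, s, t, b, q, hs, rfl, rfl⟩
      · exact absurd hρ.1 (by simpa [pathLabel] using h₁.not_matchedReturn he')
    · rcases List.cons_eq_append_iff.1 h₃ with ⟨rfl, h₄⟩ | ⟨z, rfl, -⟩
      · obtain ⟨rfl, -⟩ : e' = _ ∧ _ := by simpa using h₄
        exact ⟨f, p, a, s, t, b, q, hs, rfl, rfl⟩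
      · exact absurd h₁.1 (by simpa [pathLabel] using hρ.not_matchedReturn hs.2.1)
  · obtain ⟨rfl, rfl⟩ : e = _ ∧ π₁ ++ e' :: π₂ = ρ := by
      simpa [hC.right_eq_nil hf] using hY
    exact absurd (hq.matchedReturn (by simp))
      (by simpa [pathLabel] using h₁.not_matchedReturn he')

theorem Full.isAdmissible {π : List (FrameEdge A Q)} (h : Full P V π) :
    IsAdmissible P (frameAutomaton P V) π := by
  refine ⟨⟨fun e he => ?_, ?_⟩, ?_⟩
  · obtain ⟨X, Y, rfl⟩ := List.append_of_mem he
    exact ⟨X, Y, h⟩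
  · obtain ⟨x, hx⟩ := h.zip
    exact hx.isChain.1
  · rintro π₀ e π₁ e' π₂ rfl hc hr h₁
    exact Full.matched (by simpa using h) hc hr h₁

/-- An edge leaving the annotated state reached by an accepting run along a path `π` may be
used to extend `π`, provided it is compatible with the matched pairs. -/
theorem Zip.extend {x : Frame Q × Q} {U π V₀ U₁ V₁ : List (FrameEdge A Q)}
    {e : FrameEdge A Q} (h : Zip P V x (U ++ π) V₀) (h' : Zip P V x U₁ (e :: V₁))
    (hm : ∀ π₀ c π₁, π = π₀ ++ c :: π₁ → P.kind c.2.1 = .call → P.kind e.2.1 = .ret →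
      IsDyck P (pathLabel π₁) → (c, e) ∈ (frameAutomaton P V).matched) :
    ∃ U' V', Full P V (U' ++ π ++ e :: V') := by
  obtain ⟨f, p⟩ := x
  obtain ⟨α, β, β', δ, p₀, hC, hE, hM, hR, hX, rfl⟩ := h
  obtain ⟨α₁, β₁, β₁', δ₁, p₁, hC₁, hE₁, hM₁, hR₁, rfl, hY₁⟩ := h'
  dsimp only at hC hE hM hR hC₁ hE₁ hM₁ hR₁
  rcases List.cons_eq_append_iff.1 hY₁ with ⟨rfl, rfl⟩ | ⟨z, rfl, rfl⟩
  swap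
  · exact ⟨U, z ++ δ, by simpa [hX] using hC.fill hE hM hR₁⟩
  rcases hR₁.casesHead with ⟨-, hx⟩ | ⟨a, q, ρ, hs, hq, h⟩ |
    ⟨a, s, t, b, q, ρ, σ, hs, hr, hq, h⟩ | ⟨a, s, ρ, hf, hs, hq, h⟩
  rotate_left
  · simp at h
  · simp at h
  · simp at h
  rcases hx with hx | ⟨hx, -⟩
  swap
  · exact absurd (hC₁.right_eq_nil hx) (by simp)
  obtain ⟨g₁, α₁', δ₁', γ₁, γ₁', r₁, r₁', a₁, s, b, q, rfl, hC₁', hE₁', hM₁', hS₁, hR₁', rfl,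
    hY₁⟩ := hC₁.closed_cases hx
  obtain ⟨rfl, rfl⟩ : e = _ ∧ V₁ = _ := by simpa using hY₁
  obtain ⟨g, α', δ', γ, γ', r, r', a, s', b', q', hf, hC', hE', hM', hS, hR', rfl, rfl⟩ :=
    hC.closed_cases hx
  obtain rfl : s = s' := by simpa using hf
  obtain rfl : s = p₀ := by simpa [IsEntry] using hE
  have aux : ∀ β₀, β = β₀ ++ π →
      ∃ U' V', Full P V (U' ++ π ++ (((some s, some p), p), b, (g₁, q)) :: V') := by
    rintro β₀ rfl
    exact ⟨α₁' ++ γ₁ ++ [((g₁, r₁'), a₁, ((some s, some p), s))] ++ β₀, γ₁' ++ δ₁',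
      by simpa using hC₁.fill hE hM hR₁⟩
  rcases List.append_eq_append_iff.1 hX with ⟨z, hz, rfl⟩ | ⟨z, rfl, rfl⟩
  swap
  · exact aux _ rfl
  rcases List.eq_nil_or_concat z with rfl | ⟨z, c, rfl⟩
  · exact aux [] rfl
  simp only [List.concat_eq_append] at hz hm ⊢
  obtain ⟨hz', rfl⟩ : α' ++ γ = U ++ z ∧ ((g, r'), a, ((some s, some p), s)) = c := by
    rw [← List.append_assoc] at hz
    simpa using List.append_inj' hz rfl
  obtain ⟨-, -, f, p', a', s', t', b'', q'', hS', h₁, h₂⟩ :=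
    hm z ((g, r'), a, ((some s, some p), s)) β (by simp) hS.1 hS₁.2.1 (hM.isDyck (by simp))
  dsimp only at h₁ h₂
  obtain ⟨⟨rfl, rfl⟩, rfl, rfl, rfl⟩ :
      (g = f ∧ r' = p') ∧ a = a' ∧ s = s' ∧ p = t' := by
    simp only [Prod.mk.injEq, Option.some.injEq] at h₁
    tauto
  obtain ⟨rfl, rfl, rfl⟩ : b = b'' ∧ g₁ = g ∧ q = q'' := by
    simp only [Prod.mk.injEq] at h₂
    tauto
  have := hC'.fill hE' hM' (.nest hS' hM hR₁')
  rw [hz'] at this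
  exact ⟨U, γ₁' ++ δ', by simpa using this⟩

end VPA

theorem IsAdmissible.of_append {S : Type*} {P : PushdownAlphabet A} {𝒜 : DyckAutomaton A S}
    {U π W : List (S × A × S)} (h : IsAdmissible P 𝒜 (U ++ π ++ W)) : IsAdmissible P 𝒜 π := by
  obtain ⟨⟨h₁, h₂⟩, h₃⟩ := h
  refine ⟨⟨fun e he => h₁ e (by simp [he]), ?_⟩, ?_⟩
  · exact (List.isChain_append.1 (List.isChain_append.1 h₂).1).2.1
  · rintro π₀ e π₁ f π₂ rfl
    exact h₃ (U ++ π₀) e π₁ f (π₂ ++ W) (by simp)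

namespace VPA

variable {P V}

/-- Every nonempty admissible path of the automaton of frames, with its next position, is
followed by some accepting run. -/
theorem exists_zip_of_isAdmissible (π : List (FrameEdge A Q)) :
    ∀ e, IsAdmissible P (frameAutomaton P V) (π ++ [e]) →
      ∃ U W, Zip P V e.2.2 (U ++ (π ++ [e])) W := by
  have key : ∀ {U π W : List (FrameEdge A Q)} {e}, Full P V (U ++ π ++ e :: W) →
      ∃ U W, Zip P V e.2.2 (U ++ (π ++ [e])) W := by
    intro U π W e h
    obtain ⟨x, hx⟩ := h.exists_zip
    exact ⟨U, W, by simpa using hx.cons.2⟩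
  induction π using List.reverseRecOn with
  | nil =>
    intro e h
    obtain ⟨U, W, h⟩ := h.1.1 e (by simp)
    exact key (π := []) (by simpa using h)
  | append_singleton π l ih =>
    intro e h
    obtain ⟨U, W, hz⟩ := ih l (IsAdmissible.of_append (U := []) (W := [e]) (by simpa using h))
    obtain ⟨U₁, W₁, hF⟩ := h.1.1 e (by simp)
    have hle : l.2.2 = e.1 := by
      have := h.1.2
      simp only [List.append_assoc, List.singleton_append] at this
      simpa using (List.isChain_append.1 this).2.1
    obtain ⟨x, hx⟩ := hF.exists_zip
    rw [hle, hx.cons.1] at hz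
    obtain ⟨U', W', h'⟩ := hz.extend hx fun π₀ c π₁ hπ hc he hd =>
      h.2 π₀ c π₁ e [] (by simp [hπ]) hc he hd
    exact key h'

theorem Mid.steps {f : Frame Q} {p q : Q} {π : List (FrameEdge A Q)} (h : Mid P V f p π q) :
    ∀ {σ : List Γ} {w : List A} {c : Q × List Γ}, (f.1 = none → σ = []) →
      Steps P V (q, σ) w c → Steps P V (p, σ) (pathLabel π ++ w) c := by
  induction h with
  | nil => exact fun _ h => h
  | step hs _ ih =>
    intro σ w c hσ h
    rcases hs with ⟨hk, hs⟩ | ⟨hf, hk, hs⟩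
    · exact .internal hk hs (ih hσ h)
    · obtain rfl := hσ hf
      exact .popBot hk hs (ih hσ h)
  | nest hm _ _ ih₁ ih₂ =>
    intro σ w c hσ h
    obtain ⟨ha, hb, γ, hγ, h₁, h₂⟩ := hm
    have := Steps.call ha h₁ hγ (ih₁ (by simp) (.pop hb h₂ hγ (ih₂ hσ h)))
    simpa [pathLabel] using this

theorem Comp.steps {f : Frame Q} {p : Q} {π : List (FrameEdge A Q)} (h : Comp P V f p π) :
    ∀ {σ : List Γ}, f.2 = none → (f.1 = none → σ = []) →
      ∃ q ∈ V.final, ∃ τ, Steps P V (p, σ) (pathLabel π) (q, τ) := by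
  induction h with
  | exit h hx =>
    intro σ hf hσ
    rcases hx with hx | ⟨-, hx⟩
    · simp [hf] at hx
    · exact ⟨_, hx, σ, by simpa using h.steps hσ (.refl _)⟩
  | pending h _ hs _ ih =>
    intro σ hf hσ
    obtain ⟨ha, γ, hγ, hs⟩ := hs
    obtain ⟨q, hq, τ, hrun⟩ := ih (σ := σ ++ [γ]) rfl (by simp)
    exact ⟨q, hq, τ, by simpa [pathLabel] using h.steps hσ (.call ha hs hγ hrun)⟩

/-- Parsing a run ending in a final state: either it never pops the current top of the stack,
or it can be cut at the transition popping it. -/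
theorem Steps.parse (n : ℕ) : ∀ {w : List A} {p : Q} {σ : List Γ} {c : Q × List Γ},
    w.length ≤ n → Steps P V (p, σ) w c → c.1 ∈ V.final →
      (σ = [] → ∃ π, Comp P V (none, none) p π ∧ pathLabel π = w) ∧
      ∀ σ₀ γ, σ = σ₀ ++ [γ] →
        (∀ s, ∃ π, Comp P V (some s, none) p π ∧ pathLabel π = w) ∨
        ∃ w₁ b w₂ t q, w = w₁ ++ b :: w₂ ∧ (∀ f, ∃ π, Mid P V f p π t ∧ pathLabel π = w₁) ∧
          P.kind b = .ret ∧ γ ≠ V.bot ∧ (t, b, γ, q) ∈ V.pop ∧ Steps P V (q, σ₀) w₂ c := by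
  induction n with
  | zero =>
    intro w p σ c hw h hc
    obtain rfl : w = [] := by simpa using hw
    cases h
    exact ⟨fun _ => ⟨[], .exit (.nil _ _) (.inr ⟨rfl, hc⟩), rfl⟩,
      fun _ _ _ => .inl fun s => ⟨[], .exit (.nil _ _) (.inr ⟨rfl, hc⟩), rfl⟩⟩
  | succ n ih =>
    intro w p σ c hw h hc
    cases h with
    | refl =>
      exact ⟨fun _ => ⟨[], .exit (.nil _ _) (.inr ⟨rfl, hc⟩), rfl⟩,
        fun _ _ _ => .inl fun s => ⟨[], .exit (.nil _ _) (.inr ⟨rfl, hc⟩), rfl⟩⟩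
    | @call _ _ a q γ w _ ha hp hγ h =>
      simp only [List.length_cons, Nat.add_le_add_iff_right] at hw
      rcases (ih hw h hc).2 σ γ rfl with h' | ⟨w₁, b, w₂, t, q', rfl, hM, hb, -, hpop, h'⟩
      · have aux : ∀ f : Frame Q, f.2 = none →
            ∃ π, Comp P V f p π ∧ pathLabel π = a :: w := by
          intro f hf
          obtain ⟨π, hπ, rfl⟩ := h' q
          exact ⟨_, .pending (.nil _ _) hf ⟨ha, γ, hγ, hp⟩ hπ, rfl⟩
        exact ⟨fun _ => aux _ rfl, fun _ _ _ => .inl fun s => aux _ rfl⟩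
      · have hm : MatchStep P V p a q t b q' := ⟨ha, hb, γ, hγ, hp, hpop⟩
        obtain ⟨ρ, hρ, rfl⟩ := hM (some q, some t)
        have hw₂ : w₂.length ≤ n := by
          simp only [List.length_append, List.length_cons] at hw
          omega
        obtain ⟨h₁, h₂⟩ := ih hw₂ h' hc
        have aux : ∀ f : Frame Q, (∃ π, Comp P V f q' π ∧ pathLabel π = w₂) →
            ∃ π, Comp P V f p π ∧ pathLabel π = a :: (pathLabel ρ ++ b :: w₂) := by
          rintro f ⟨π, hπ, rfl⟩
          exact ⟨_, .nest hm hρ hπ, by simp [pathLabel]⟩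
        refine ⟨fun hσ => aux _ (h₁ hσ), fun σ₀ γ₀ hσ => ?_⟩
        rcases h₂ σ₀ γ₀ hσ with h₃ | ⟨u₁, d, u₂, t', r, rfl, hM', hd⟩
        · exact .inl fun s => aux _ (h₃ s)
        · refine .inr ⟨a :: (pathLabel ρ ++ b :: u₁), d, u₂, t', r, by simp, fun f => ?_, hd⟩
          obtain ⟨π, hπ, rfl⟩ := hM' f
          exact ⟨_, .nest hm hρ hπ, by simp [pathLabel]⟩
    | @pop _ _ b γ q w _ hb hp hγ h =>
      refine ⟨by simp, fun σ₀ γ₀ hσ => .inr ?_⟩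
      obtain ⟨rfl, h'⟩ := List.append_inj' hσ rfl
      obtain rfl : γ = γ₀ := by simpa using h'
      exact ⟨[], b, w, p, q, rfl, fun f => ⟨[], .nil _ _, rfl⟩, hb, hγ, hp, h⟩
    | popBot hb hp h =>
      simp only [List.length_cons, Nat.add_le_add_iff_right] at hw
      refine ⟨fun _ => ?_, by simp⟩
      obtain ⟨π, hπ, rfl⟩ := (ih hw h hc).1 rfl
      exact ⟨_, (Mid.step (.inr ⟨rfl, hb, hp⟩) (.nil _ _)).append_comp hπ, rfl⟩
    | @internal _ _ a q w _ ha hi h =>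
      simp only [List.length_cons, Nat.add_le_add_iff_right] at hw
      obtain ⟨h₁, h₂⟩ := ih hw h hc
      have hs : ∀ f, LevelStep P V f p a q := fun f => .inl ⟨ha, hi⟩
      have aux : ∀ f : Frame Q, (∃ π, Comp P V f q π ∧ pathLabel π = w) →
          ∃ π, Comp P V f p π ∧ pathLabel π = a :: w := by
        rintro f ⟨π, hπ, rfl⟩
        exact ⟨_, (Mid.step (hs f) (.nil _ _)).append_comp hπ, rfl⟩
      refine ⟨fun hσ => aux _ (h₁ hσ), fun σ₀ γ₀ hσ => ?_⟩
      rcases h₂ σ₀ γ₀ hσ with h₃ | ⟨u₁, d, u₂, t', r, rfl, hM', hd⟩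
      · exact .inl fun s => aux _ (h₃ s)
      · refine .inr ⟨a :: u₁, d, u₂, t', r, rfl, fun f => ?_, hd⟩
        obtain ⟨π, hπ, rfl⟩ := hM' f
        exact ⟨_, .step (hs f) hπ, rfl⟩

theorem accepts_iff_exists_full {w : List A} :
    Accepts P V w ↔ ∃ π, Full P V π ∧ pathLabel π = w := by
  constructor
  · rintro ⟨p, q, σ, hp, hq, h⟩
    obtain ⟨π, hπ, rfl⟩ := (Steps.parse _ le_rfl h hq).1 rfl
    exact ⟨π, ⟨p, hp, hπ⟩, rfl⟩
  · rintro ⟨π, ⟨p, hp, h⟩, rfl⟩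
    obtain ⟨q, hq, τ, h⟩ := h.steps (σ := []) rfl (fun _ => rfl)
    exact ⟨p, q, τ, hp, hq, h⟩

end VPA

end Runs

section Presentation

variable {A S : Type*} {P : PushdownAlphabet A} {𝒜 : DyckAutomaton A S}

theorem pathSeg_eq (π : ℤ → S × A × S) (i : ℤ) (n : ℕ) :
    pathSeg π i n = (List.range n).map fun k : ℕ => π (i + k) := by
  simp [pathSeg, ← List.map_eq_flatMap]

theorem factorAt_eq (x : ℤ → A) (i : ℤ) (n : ℕ) :
    factorAt x i n = (List.range n).map fun k : ℕ => x (i + k) := by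
  simp [factorAt, ← List.map_eq_flatMap]

theorem pathSeg_add (π : ℤ → S × A × S) (i : ℤ) (m n : ℕ) :
    pathSeg π i (m + n) = pathSeg π i m ++ pathSeg π (i + m) n := by
  simp [pathSeg_eq, List.range_add, add_assoc, Function.comp_def]

theorem pathLabel_pathSeg (π : ℤ → S × A × S) (i : ℤ) (n : ℕ) :
    pathLabel (pathSeg π i n) = factorAt (fun k => (π k).2.1) i n := by
  simp [pathLabel, pathSeg_eq, factorAt_eq]

theorem length_factorAt (x : ℤ → A) (i : ℤ) (n : ℕ) : (factorAt x i n).length = n := by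
  simp [factorAt_eq]

theorem exists_pathSeg_eq {π : List (S × A × S)} (hπ : π ≠ []) (i : ℤ) :
    ∃ g : ℤ → S × A × S, pathSeg g i π.length = π := by
  refine ⟨fun k => π.getD (k - i).toNat (π.head hπ), List.ext_getElem (by simp [pathSeg_eq]) ?_⟩
  intro n h₁ h₂
  simp [pathSeg_eq, h₂]

theorem IsAdmissible.pathSeg_of_le {g : ℤ → S × A × S} {i j : ℤ} {m n : ℕ}
    (h : IsAdmissible P 𝒜 (pathSeg g j n)) (hj : j ≤ i) (hn : i + m ≤ j + n) :
    IsAdmissible P 𝒜 (pathSeg g i m) := by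
  obtain ⟨a, rfl⟩ := Int.le.dest hj
  obtain ⟨b, hb⟩ := Int.le.dest hn
  obtain rfl : n = a + m + b := by omega
  rw [pathSeg_add, pathSeg_add] at h
  exact h.of_append

theorem biAdmissible_of_forall {π : ℤ → S × A × S}
    (h : ∀ i n, IsAdmissible P 𝒜 (pathSeg π i n)) : BiAdmissible P 𝒜 π := by
  have h₂ : ∀ i, pathSeg π i 2 = [π i, π (i + 1)] := fun i => by
    simp [pathSeg_eq, List.range_succ]
  refine ⟨fun i => (h i 2).1.1 _ (by simp [h₂]), fun i => ?_, h⟩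
  have := (h i 2).1.2
  rw [h₂] at this
  exact List.isChain_pair (R := fun e f : S × A × S => e.2.2 = f.1).1 this

/-- If the labels of admissible paths are the words of a factorial language, then the
automaton presents the bi-infinite sequences all of whose factors are in the language. -/
theorem setOf_factors_eq_presents [Finite A] [Finite S] {L : Set (List A)}
    (hfac : FactorialLang L) (h₁ : ∀ w ∈ L, ∃ π, IsAdmissible P 𝒜 π ∧ pathLabel π = w)
    (h₂ : ∀ π, π ≠ [] → IsAdmissible P 𝒜 π → pathLabel π ∈ L) :
    {x : ℤ → A | ∀ w, IsFactorOf w x → w ∈ L} = presents P 𝒜 := by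
  ext x
  constructor
  · intro hx
    have hg : ∀ n : ℕ, ∃ g : ℤ → S × A × S, IsAdmissible P 𝒜 (pathSeg g (-n) (2 * n + 1)) ∧
        factorAt (fun k => (g k).2.1) (-n) (2 * n + 1) = factorAt x (-n) (2 * n + 1) := by
      intro n
      obtain ⟨π, hπ, hl⟩ := h₁ _ (hx (factorAt x (-n) (2 * n + 1))
        ⟨-n, by rw [length_factorAt]⟩)
      have hlen : π.length = 2 * n + 1 := by
        simpa [pathLabel, length_factorAt] using congrArg List.length hl
      obtain ⟨g, hg⟩ := exists_pathSeg_eq (π := π) (by rintro rfl; simp at hlen) (-n)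
      rw [hlen] at hg
      exact ⟨g, hg ▸ hπ, by rw [← pathLabel_pathSeg, hg, hl]⟩
    choose g hg hgl using hg
    have hlim : ∀ k : ℤ, ∃ e, ∀ᶠ n in (Filter.hyperfilter ℕ : Filter ℕ), g n k = e := by
      intro k
      obtain ⟨e, he⟩ := ((Filter.hyperfilter ℕ).map (fun n => g n k)).eq_pure_of_finite
      have : {e} ∈ (Filter.hyperfilter ℕ).map (fun n => g n k) := by
        rw [he]; exact Ultrafilter.mem_pure.2 rfl
      exact ⟨e, this⟩
    choose π hπ using hlim
    have hwin : ∀ (i : ℤ) (m N : ℕ), ∃ n, N ≤ n ∧ pathSeg (g n) i m = pathSeg π i m := by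
      intro i m N
      have h₃ : ∀ᶠ n in (Filter.hyperfilter ℕ : Filter ℕ),
          ∀ k ∈ Finset.range m, g n (i + k) = π (i + k) :=
        (Filter.eventually_all_finset _).2 fun k _ => hπ _
      have h₄ : ∀ᶠ n in (Filter.hyperfilter ℕ : Filter ℕ), N ≤ n :=
        Nat.hyperfilter_le_atTop (Filter.eventually_ge_atTop N)
      obtain ⟨n, hn, hN⟩ := (h₃.and h₄).exists
      refine ⟨n, hN, ?_⟩
      rw [pathSeg_eq, pathSeg_eq]
      exact List.map_congr_left fun k hk => hn k (by simpa using hk)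
    refine ⟨π, biAdmissible_of_forall fun i m => ?_, fun i => ?_⟩
    · obtain ⟨n, hn, h⟩ := hwin i m (i.natAbs + m)
      rw [← h]
      exact (hg n).pathSeg_of_le (by omega) (by push_cast; omega)
    · obtain ⟨n, hn, h⟩ := hwin i 1 i.natAbs
      have h₃ : g n i = π i := by simpa [pathSeg_eq] using h
      have h₄ := hgl n
      rw [factorAt_eq, factorAt_eq] at h₄
      replace h₄ := List.map_inj_left.1 h₄ (i + n).toNat (List.mem_range.2 (by omega))
      have h₅ : -(n : ℤ) + ((i + n).toNat : ℤ) = i := by omega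
      rwa [h₅, h₃] at h₄
  · rintro ⟨π, hπ, hl⟩ w ⟨i, hw⟩
    have hne : pathSeg π i (w.length + 1) ≠ [] := by simp [pathSeg_eq]
    have hlab : pathLabel (pathSeg π i w.length) = w := by
      rw [pathLabel_pathSeg, funext hl, ← hw]
    have h := h₂ _ hne (hπ.2.2 i (w.length + 1))
    have hsplit : pathLabel (pathSeg π i (w.length + 1)) =
        w ++ pathLabel (pathSeg π (i + w.length) 1) := by
      rw [pathSeg_add, pathLabel, List.map_append]
      exact congrArg (· ++ _) hlab
    exact hfac [] w _ (hsplit ▸ h)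

/-- Relabeling of the states of a Dyck automaton. -/
def DyckAutomaton.comap {T : Type*} (φ : T → S) (𝒜 : DyckAutomaton A S) :
    DyckAutomaton A T where
  edges := {e | (φ e.1, e.2.1, φ e.2.2) ∈ 𝒜.edges}
  matched := {m | ((φ m.1.1, m.1.2.1, φ m.1.2.2), (φ m.2.1, m.2.2.1, φ m.2.2.2)) ∈ 𝒜.matched}

theorem isAdmissible_comap {T : Type*} {φ : T → S} (hφ : Function.Injective φ)
    {π : List (T × A × T)} : IsAdmissible P (𝒜.comap φ) π ↔
      IsAdmissible P 𝒜 (π.map fun e => (φ e.1, e.2.1, φ e.2.2)) := by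
  refine and_congr (and_congr (by simp only [List.forall_mem_map]; rfl) ?_)
    ⟨fun h => ?_, fun h => ?_⟩
  · change List.IsChain _ _ ↔ List.IsChain _ _
    simp [List.isChain_map, hφ.eq_iff]
  · intro π₀ e π₁ f π₂ hπ he hf hd
    obtain ⟨ρ, τ, rfl, hρ, hτ⟩ := List.map_eq_append_iff.1 hπ
    obtain ⟨ρ₀, ρ', rfl, rfl, hρ'⟩ := List.map_eq_append_iff.1 hρ
    obtain ⟨e', ρ₁, rfl, rfl, rfl⟩ := List.map_eq_cons_iff.1 hρ'
    obtain ⟨f', ρ₂, rfl, rfl, rfl⟩ := List.map_eq_cons_iff.1 hτ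
    exact h ρ₀ e' ρ₁ f' ρ₂ rfl he hf (by simpa [pathLabel, Function.comp_def] using hd)
  · rintro π₀ e π₁ f π₂ rfl he hf hd
    let ψ : T × A × T → S × A × S := fun e => (φ e.1, e.2.1, φ e.2.2)
    exact h (π₀.map ψ) (ψ e) (π₁.map ψ) (ψ f) (π₂.map ψ) (by simp [ψ]) he hf
      (by simpa [pathLabel, Function.comp_def, ψ] using hd)

theorem DyckAutomaton.WellFormed.isSoficDyck [Finite S] (h𝒜 : 𝒜.WellFormed P) {L : Set (List A)}
    [Finite A] (hfac : FactorialLang L)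
    (h₁ : ∀ w ∈ L, ∃ π, IsAdmissible P 𝒜 π ∧ pathLabel π = w)
    (h₂ : ∀ π, π ≠ [] → IsAdmissible P 𝒜 π → pathLabel π ∈ L) :
    IsSoficDyck P {x : ℤ → A | ∀ w, IsFactorOf w x → w ∈ L} := by
  obtain ⟨N, ⟨φ⟩⟩ := Finite.exists_equiv_fin S
  refine ⟨N, 𝒜.comap φ.symm, fun e f h => h𝒜 _ _ h, setOf_factors_eq_presents hfac ?_ ?_⟩
  · intro w hw
    obtain ⟨π, hπ, rfl⟩ := h₁ w hw
    refine ⟨π.map fun e => (φ e.1, e.2.1, φ e.2.2), ?_, by simp [pathLabel]⟩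
    rw [isAdmissible_comap φ.symm.injective]
    simpa [Function.comp_def] using hπ
  · intro π hne hπ
    rw [isAdmissible_comap φ.symm.injective] at hπ
    simpa [pathLabel, Function.comp_def] using h₂ _ (by simpa using hne) hπ

end Presentation

end SD

/-- If `L` is a factorial extensible visibly pushdown language then the set of
bi-infinite sequences all of whose finite factors belong to `L` is a sofic-Dyck
shift. -/
theorem statement_14 {A : Type*} [Fintype A] (P : PushdownAlphabet A)
    (L : Set (List A)) (hfac : FactorialLang L) (hext : ExtensibleLang L)
    (hvpl : IsVPL P L) :
    IsSoficDyck P { x : ℤ → A | ∀ w : List A, IsFactorOf w x → w ∈ L } := by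
  obtain ⟨nQ, nΓ, V, rfl⟩ := hvpl
  refine VPA.frameAutomaton_wellFormed (P := P) (V := V) |>.isSoficDyck hfac ?_ ?_
  · intro w hw
    obtain ⟨π, hπ, rfl⟩ := VPA.accepts_iff_exists_full.1 hw
    exact ⟨π, hπ.isAdmissible, rfl⟩
  · intro π hne hπ
    obtain ⟨π, e, rfl⟩ := (List.eq_nil_or_concat π).resolve_left hne
    obtain ⟨U, W, h⟩ := VPA.exists_zip_of_isAdmissible π e (by simpa using hπ)
    refine hfac (pathLabel U) _ (pathLabel W) (VPA.accepts_iff_exists_full.2 ⟨_, h.full, ?_⟩)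
    simp [pathLabel]
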